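/- There exists a constant c > 0 such that for all real X ≥ 3, the number of positive integers n ≤ X that are NOT expressible as n = x·y·z + x + y + z with positive integers x, y, z is at most c·X·(log log X)/(log X)³. -/

import Mathlib

open Finset

section Selberg
open scoped ArithmeticFunction.Moebius
open BoundingSieve

/-- For squarefree `m`, the Möbius sum over `l ∣ d ∣ m`. -/
lemma sum_moebius_between {P l m : ℕ} (hP : Squarefree P) (hm : m ∣ P) (hl : l ∣ P) :
    (∑ d ∈ P.divisors, if l ∣ d ∧ d ∣ m then (μ d : ℝ) else 0) = if l = m then (μ l : ℝ) else 0 := by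
  have hP0 := hP.ne_zero
  have hm0 : m ≠ 0 := ne_zero_of_dvd_ne_zero hP0 hm
  have hl0 : l ≠ 0 := ne_zero_of_dvd_ne_zero hP0 hl
  by_cases hlm : l ∣ m
  · obtain ⟨k, rfl⟩ := hlm
    have hk0 : k ≠ 0 := by rintro rfl; simp at hm0
    have hsq : Squarefree (l * k) := hP.squarefree_of_dvd hm
    rw [← Finset.sum_filter]
    have himg : P.divisors.filter (fun d => l ∣ d ∧ d ∣ l * k) = k.divisors.image (fun e => l * e) := by
      ext d
      simp only [mem_filter, Nat.mem_divisors, mem_image]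
      constructor
      · rintro ⟨_, ⟨e, rfl⟩, h2⟩
        exact ⟨e, ⟨Nat.dvd_of_mul_dvd_mul_left (Nat.pos_of_ne_zero hl0) h2, hk0⟩, rfl⟩
      · rintro ⟨e, ⟨he, _⟩, rfl⟩
        have : l * e ∣ l * k := Nat.mul_dvd_mul_left l he
        exact ⟨⟨this.trans hm, hP0⟩, Dvd.intro _ rfl, this⟩
    rw [himg, Finset.sum_image (by
      intro a _ b _ h
      exact Nat.eq_of_mul_eq_mul_left (Nat.pos_of_ne_zero hl0) h)]
    have h1 : ∀ e ∈ k.divisors, (μ (l * e) : ℝ) = (μ l : ℝ) * (μ e : ℝ) := by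
      intro e he
      have hc : Nat.Coprime l e :=
        Nat.Coprime.coprime_dvd_right (Nat.dvd_of_mem_divisors he) (Nat.coprime_of_squarefree_mul hsq)
      rw [ArithmeticFunction.isMultiplicative_moebius.map_mul_of_coprime hc]
      push_cast; ring
    rw [Finset.sum_congr rfl h1, ← Finset.mul_sum]
    have h2 : (∑ e ∈ k.divisors, (μ e : ℝ)) = if k = 1 then 1 else 0 := by
      have h3 := congrArg (fun f : ArithmeticFunction ℝ => f k)
        (ArithmeticFunction.coe_zeta_mul_coe_moebius (R := ℝ))
      simp only [ArithmeticFunction.coe_zeta_mul_apply, ArithmeticFunction.intCoe_apply,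
        ArithmeticFunction.one_apply] at h3
      exact h3
    rw [h2]
    have : (l = l * k) ↔ k = 1 := by
      constructor
      · intro h; exact Nat.eq_of_mul_eq_mul_left (Nat.pos_of_ne_zero hl0) (by omega)
      · rintro rfl; simp
    simp only [this]; simp
  · rw [if_neg (by rintro rfl; exact hlm dvd_rfl)]
    apply Finset.sum_eq_zero
    intro d _
    rw [if_neg]
    rintro ⟨h1, h2⟩
    exact hlm (h1.trans h2)

/-- A crude form of the Selberg upper bound sieve. -/
theorem selberg_crude (s : BoundingSieve) (D : ℕ) (hD : 1 ≤ D) (ρ : ℕ → ℝ) (K : ℝ) (hK : 0 ≤ K)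
    (hrem : ∀ d, d ∣ s.prodPrimes → |s.rem d| ≤ K * ρ d)
    (hlcm : ∀ d₁ d₂, d₁ ∣ s.prodPrimes → d₂ ∣ s.prodPrimes → ρ (Nat.lcm d₁ d₂) ≤ ρ d₁ * ρ d₂)
    (hρ0 : ∀ d, 0 ≤ ρ d)
    (hρ : ∀ d, d ∣ s.prodPrimes → ρ d ≤ d * s.nu d) :
    s.siftedSum ≤ s.totalMass / (∑ l ∈ s.prodPrimes.divisors with l ≤ D, s.selbergTerms l)
      + K * (D : ℝ) ^ 4 := by
  classical
  set P := s.prodPrimes with hPdef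
  have hP : Squarefree P := s.prodPrimes_squarefree
  have hP0 : P ≠ 0 := hP.ne_zero
  set L := ∑ l ∈ P.divisors with l ≤ D, s.selbergTerms l with hL
  have hg : ∀ l, l ∣ P → 0 < s.selbergTerms l := fun l hl => selbergTerms_pos hl
  have hnu : ∀ l, l ∣ P → 0 < s.nu l := fun l hl => nu_pos_of_dvd_prodPrimes hl
  have hLpos : 0 < L := by
    apply Finset.sum_pos
    · intro l hl
      simp only [mem_filter, Nat.mem_divisors] at hl
      exact hg l hl.1.1
    · exact ⟨1, by simp [hP0, hD]⟩
  let G : ℕ → ℝ := fun d => ∑ l ∈ P.divisors with l ≤ D, if d ∣ l then s.selbergTerms l else 0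
  have hG0 : ∀ d, 0 ≤ G d := by
    intro d
    apply Finset.sum_nonneg
    intro l hl
    simp only [mem_filter, Nat.mem_divisors] at hl
    split_ifs
    · exact (hg l hl.1.1).le
    · exact le_rfl
  have hGL : ∀ d, G d ≤ L := by
    intro d
    apply Finset.sum_le_sum
    intro l hl
    simp only [mem_filter, Nat.mem_divisors] at hl
    split_ifs
    · exact le_rfl
    · exact (hg l hl.1.1).le
  have hGD : ∀ d, D < d → G d = 0 := by
    intro d hd
    apply Finset.sum_eq_zero
    intro l hl
    simp only [mem_filter, Nat.mem_divisors] at hl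
    rw [if_neg]
    intro h
    have := Nat.le_of_dvd (Nat.pos_of_ne_zero (ne_zero_of_dvd_ne_zero hP0 hl.1.1)) h
    omega
  let w : ℕ → ℝ := fun d => (s.nu d)⁻¹ * (μ d : ℝ) * G d / L
  have hw1 : w 1 = 1 := by
    have h1 : G 1 = L := by
      simp only [G, hL]
      apply Finset.sum_congr rfl
      intro l _
      simp
    simp only [w, h1, s.nu_mult.map_one, ArithmeticFunction.moebius_apply_one]
    field_simp
    simp
  have hwD : ∀ d, D < d → w d = 0 := by
    intro d hd
    simp [w, hGD d hd]
  have hmuabs : ∀ d : ℕ, |(μ d : ℝ)| ≤ 1 := by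
    intro d
    have := ArithmeticFunction.abs_moebius_le_one (n := d)
    exact_mod_cast this
  have hwρ : ∀ d, d ∣ P → |w d| * ρ d ≤ d := by
    intro d hd
    have hn := hnu d hd
    have : |w d| ≤ (s.nu d)⁻¹ := by
      simp only [w, abs_div, abs_mul, abs_inv, abs_of_pos hn, abs_of_pos hLpos, abs_of_nonneg (hG0 d)]
      rw [div_le_iff₀ hLpos]
      have h1 : (s.nu d)⁻¹ * |(μ d : ℝ)| ≤ (s.nu d)⁻¹ := by
        have := inv_pos.mpr hn
        nlinarith [hmuabs d]
      exact mul_le_mul h1 (hGL d) (hG0 d) (inv_pos.mpr hn).le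
    calc |w d| * ρ d ≤ (s.nu d)⁻¹ * (d * s.nu d) :=
          mul_le_mul this (hρ d hd) (hρ0 d) (inv_pos.mpr hn).le
      _ = d := by field_simp
  have hmain : s.mainSum (lambdaSquared w) = 1 / L := by
    rw [mainSum_lambdaSquared_eq_sum_mul_sum_sq]
    have hinner : ∀ l ∈ P.divisors, (∑ d ∈ P.divisors, if l ∣ d then s.nu d * w d else 0) =
        if l ≤ D then (μ l : ℝ) * s.selbergTerms l / L else 0 := by
      intro l hl
      have hlP := Nat.dvd_of_mem_divisors hl
      calc (∑ d ∈ P.divisors, if l ∣ d then s.nu d * w d else 0)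
          = ∑ d ∈ P.divisors, ∑ m ∈ P.divisors with m ≤ D,
              (s.selbergTerms m / L) * (if l ∣ d ∧ d ∣ m then (μ d : ℝ) else 0) := by
            apply Finset.sum_congr rfl
            intro d hd
            have hn := hnu d (Nat.dvd_of_mem_divisors hd)
            split_ifs with h
            · have : s.nu d * w d = (μ d : ℝ) / L * G d := by
                simp only [w]; field_simp
              rw [this]
              simp only [G, Finset.mul_sum]
              apply Finset.sum_congr rfl
              intro m _
              by_cases hdm : d ∣ m
              · simp [h, hdm]; ring
              · simp [hdm]
            · simp [h]
        _ = ∑ m ∈ P.divisors with m ≤ D, (s.selbergTerms m / L) *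
              (∑ d ∈ P.divisors, if l ∣ d ∧ d ∣ m then (μ d : ℝ) else 0) := by
            rw [Finset.sum_comm]
            simp_rw [Finset.mul_sum]
        _ = ∑ m ∈ P.divisors with m ≤ D, (s.selbergTerms m / L) *
              (if l = m then (μ l : ℝ) else 0) := by
            apply Finset.sum_congr rfl
            intro m hm
            simp only [mem_filter, Nat.mem_divisors] at hm
            rw [sum_moebius_between hP hm.1.1 hlP]
        _ = _ := by
            simp only [mul_ite, mul_zero, Finset.sum_ite_eq, mem_filter, hl, true_and]
            split_ifs
            · ring
            · rfl
    have : ∀ l ∈ P.divisors, (s.selbergTerms l)⁻¹ *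
        (∑ d ∈ P.divisors, if l ∣ d then s.nu d * w d else 0) ^ 2 =
        if l ≤ D then s.selbergTerms l / L ^ 2 else 0 := by
      intro l hl
      have hlP := Nat.dvd_of_mem_divisors hl
      rw [hinner l hl]
      split_ifs
      · have h2 : (μ l : ℝ) ^ 2 = 1 := by
          have := ArithmeticFunction.moebius_sq_eq_one_of_squarefree (hP.squarefree_of_dvd hlP)
          exact_mod_cast this
        have := (hg l hlP).ne'
        rw [div_pow, mul_pow, h2]
        field_simp
      · simp
    rw [Finset.sum_congr rfl this, ← Finset.sum_filter, ← Finset.sum_div, ← hL]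
    field_simp
  have herr : s.errSum (lambdaSquared w) ≤ K * (D : ℝ) ^ 4 := by
    calc s.errSum (lambdaSquared w)
        ≤ ∑ d ∈ P.divisors, ∑ d₁ ∈ P.divisors, ∑ d₂ ∈ P.divisors,
            (if d = Nat.lcm d₁ d₂ then K * ((|w d₁| * ρ d₁) * (|w d₂| * ρ d₂)) else 0) := by
          apply Finset.sum_le_sum
          intro d hd
          have hdP := Nat.dvd_of_mem_divisors hd
          have hsub : d.divisors ⊆ P.divisors := Nat.divisors_subset_of_dvd hP0 hdP
          have hnn : ∀ d₁ d₂, 0 ≤ (if d = Nat.lcm d₁ d₂ then K * ((|w d₁| * ρ d₁) * (|w d₂| * ρ d₂)) else 0) := by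
            intro d₁ d₂
            have := hρ0 d₁
            have := hρ0 d₂
            split_ifs <;> positivity
          calc |lambdaSquared w d| * |s.rem d|
              ≤ (∑ d₁ ∈ d.divisors, ∑ d₂ ∈ d.divisors,
                  |if d = Nat.lcm d₁ d₂ then w d₁ * w d₂ else 0|) * |s.rem d| := by
                apply mul_le_mul_of_nonneg_right _ (abs_nonneg _)
                refine (Finset.abs_sum_le_sum_abs _ _).trans ?_
                exact Finset.sum_le_sum fun _ _ => Finset.abs_sum_le_sum_abs _ _
            _ = ∑ d₁ ∈ d.divisors, ∑ d₂ ∈ d.divisors,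
                  |if d = Nat.lcm d₁ d₂ then w d₁ * w d₂ else 0| * |s.rem d| := by
                simp_rw [Finset.sum_mul]
            _ ≤ ∑ d₁ ∈ d.divisors, ∑ d₂ ∈ d.divisors,
                  (if d = Nat.lcm d₁ d₂ then K * ((|w d₁| * ρ d₁) * (|w d₂| * ρ d₂)) else 0) := by
                apply Finset.sum_le_sum
                intro d₁ hd₁
                apply Finset.sum_le_sum
                intro d₂ hd₂
                have h1 := Nat.dvd_of_mem_divisors (hsub hd₁)
                have h2 := Nat.dvd_of_mem_divisors (hsub hd₂)
                split_ifs with h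
                · rw [abs_mul]
                  have := (hrem d hdP).trans (mul_le_mul_of_nonneg_left (h ▸ hlcm d₁ d₂ h1 h2) hK)
                  calc |w d₁| * |w d₂| * |s.rem d| ≤ |w d₁| * |w d₂| * (K * (ρ d₁ * ρ d₂)) := by
                        gcongr
                    _ = _ := by ring
                · simp
            _ ≤ ∑ d₁ ∈ P.divisors, ∑ d₂ ∈ d.divisors,
                  (if d = Nat.lcm d₁ d₂ then K * ((|w d₁| * ρ d₁) * (|w d₂| * ρ d₂)) else 0) :=
                Finset.sum_le_sum_of_subset_of_nonneg hsub
                  fun _ _ _ => Finset.sum_nonneg fun _ _ => hnn _ _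
            _ ≤ _ := Finset.sum_le_sum fun _ _ =>
                Finset.sum_le_sum_of_subset_of_nonneg hsub fun _ _ _ => hnn _ _
      _ = ∑ d₁ ∈ P.divisors, ∑ d₂ ∈ P.divisors, K * ((|w d₁| * ρ d₁) * (|w d₂| * ρ d₂)) := by
          rw [Finset.sum_comm]
          apply Finset.sum_congr rfl
          intro d₁ hd₁
          rw [Finset.sum_comm]
          apply Finset.sum_congr rfl
          intro d₂ hd₂
          rw [Finset.sum_ite_eq_of_mem']
          rw [Nat.mem_divisors, Nat.lcm_dvd_iff]
          exact ⟨⟨Nat.dvd_of_mem_divisors hd₁, Nat.dvd_of_mem_divisors hd₂⟩, hP0⟩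
      _ = K * (∑ d ∈ P.divisors, |w d| * ρ d) ^ 2 := by
          rw [sq, Finset.sum_mul_sum, Finset.mul_sum]
          simp_rw [Finset.mul_sum]
      _ ≤ K * ((D : ℝ) ^ 2) ^ 2 := by
          have h0 : 0 ≤ ∑ d ∈ P.divisors, |w d| * ρ d :=
            Finset.sum_nonneg fun d _ => mul_nonneg (abs_nonneg _) (hρ0 d)
          have h1 : ∑ d ∈ P.divisors, |w d| * ρ d ≤ (D : ℝ) ^ 2 := by
            calc ∑ d ∈ P.divisors, |w d| * ρ d
                = ∑ d ∈ P.divisors with d ≤ D, |w d| * ρ d := by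
                  rw [Finset.sum_filter]
                  apply Finset.sum_congr rfl
                  intro d _
                  split_ifs with h
                  · rfl
                  · rw [hwD d (by omega)]; simp
              _ ≤ ∑ d ∈ P.divisors with d ≤ D, (D : ℝ) := by
                  apply Finset.sum_le_sum
                  intro d hd
                  simp only [mem_filter, Nat.mem_divisors] at hd
                  exact (hwρ d hd.1.1).trans (by exact_mod_cast hd.2)
              _ = ((P.divisors.filter (· ≤ D)).card : ℝ) * D := by simp
              _ ≤ (D : ℝ) * D := by
                  have : (P.divisors.filter (· ≤ D)).card ≤ (Finset.Icc 1 D).card := by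
                    apply Finset.card_le_card
                    intro d hd
                    simp only [mem_filter, mem_Icc] at hd ⊢
                    exact ⟨Nat.pos_of_mem_divisors hd.1, hd.2⟩
                  rw [Nat.card_Icc] at this
                  have h' : ((P.divisors.filter (· ≤ D)).card : ℝ) ≤ D := by exact_mod_cast this
                  gcongr
              _ = _ := by ring
          gcongr
      _ = _ := by ring
  have := s.siftedSum_le_mainSum_errSum_of_upperMoebius _ (upperMoebius_lambdaSquared w hw1)
  rw [hmain] at this
  calc _ ≤ _ := this
    _ ≤ _ := by rw [mul_one_div]; gcongr

end Selberg

section LowerBound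
open scoped ArithmeticFunction.Omega

/-- The completely multiplicative function `3^Ω(n)/n` on integers prime to `6`. -/
noncomputable def hfun : ℕ →* ℝ where
  toFun n := if Nat.Coprime n 6 then (3 : ℝ) ^ (Ω n) / n else 0
  map_one' := by simp
  map_mul' m n := by
    by_cases hm : Nat.Coprime m 6
    · by_cases hn : Nat.Coprime n 6
      · have hm0 : m ≠ 0 := by rintro rfl; norm_num at hm
        have hn0 : n ≠ 0 := by rintro rfl; norm_num at hn
        rw [if_pos (Nat.Coprime.mul_left hm hn), if_pos hm, if_pos hn,
          ArithmeticFunction.cardFactors_mul hm0 hn0, pow_add]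
        push_cast
        field_simp
      · rw [if_neg hn, if_neg, mul_zero]
        exact fun h => hn (Nat.Coprime.coprime_mul_left h)
    · rw [if_neg hm, if_neg, zero_mul]
      exact fun h => hm (Nat.Coprime.coprime_mul_right h)

lemma hfun_def (n : ℕ) : hfun n = if Nat.Coprime n 6 then (3 : ℝ) ^ (Ω n) / n else 0 := rfl

lemma hfun_apply {n : ℕ} (h : Nat.Coprime n 6) : hfun n = (3 : ℝ) ^ (Ω n) / n := if_pos h

lemma hfun_nonneg (n : ℕ) : 0 ≤ hfun n := by
  change 0 ≤ if Nat.Coprime n 6 then (3 : ℝ) ^ (Ω n) / n else 0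
  split_ifs <;> positivity

lemma prime_coprime_six {p : ℕ} (hp : p.Prime) (h2 : p ≠ 2) (h3 : p ≠ 3) : Nat.Coprime p 6 := by
  have a : Nat.Coprime p 2 := (Nat.coprime_primes hp Nat.prime_two).2 h2
  have b : Nat.Coprime p 3 := (Nat.coprime_primes hp Nat.prime_three).2 h3
  exact Nat.Coprime.mul_right a b

lemma hfun_prime {p : ℕ} (hp : p.Prime) (h2 : p ≠ 2) (h3 : p ≠ 3) : hfun p = 3 / p := by
  rw [hfun_apply (prime_coprime_six hp h2 h3), ArithmeticFunction.cardFactors_apply_prime hp, pow_one]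

lemma hfun_prime_lt {p : ℕ} (hp : p.Prime) : ‖hfun p‖ < 1 := by
  rw [Real.norm_of_nonneg (hfun_nonneg p)]
  by_cases h2 : p = 2
  · subst h2; rw [hfun_def]; norm_num
  by_cases h3 : p = 3
  · subst h3; rw [hfun_def]; norm_num
  rw [hfun_prime hp h2 h3, div_lt_one (by exact_mod_cast hp.pos)]
  have := hp.two_le
  have : 3 < p := by omega
  exact_mod_cast this

lemma fiber_bound (l : ℕ) (hl : Squarefree l) (S : Finset ℕ)
    (hS : ∀ n ∈ S, n ≠ 0 ∧ ∏ p ∈ n.primeFactors, p = l) :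
    ∑ n ∈ S, hfun n ≤ hfun l * ∏ p ∈ l.primeFactors, (1 - hfun p)⁻¹ := by
  classical
  have hdvd : ∀ n ∈ S, l ∣ n := fun n hn => (hS n hn).2 ▸ Nat.prod_primeFactors_dvd n
  have hl0 := hl.ne_zero
  have h1 : ∑ n ∈ S, hfun n = hfun l * ∑ m ∈ S.image (fun n => n / l), hfun m := by
    rw [Finset.sum_image, Finset.mul_sum]
    · apply Finset.sum_congr rfl
      intro n hn
      rw [← map_mul, Nat.mul_div_cancel' (hdvd n hn)]
    · intro a ha b hb hab
      have hab' : a / l = b / l := hab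
      rw [← Nat.mul_div_cancel' (hdvd a ha), ← Nat.mul_div_cancel' (hdvd b hb), hab']
  rw [h1]
  apply mul_le_mul_of_nonneg_left _ (hfun_nonneg l)
  have h2 := (EulerProduct.summable_and_hasSum_factoredNumbers_prod_filter_prime_geometric
    (f := hfun) hfun_prime_lt l.primeFactors).2
  have h3 : l.primeFactors.filter Nat.Prime = l.primeFactors :=
    Finset.filter_true_of_mem fun p hp => Nat.prime_of_mem_primeFactors hp
  rw [h3] at h2
  have h4 := (hasSum_subtype_iff_indicator (f := fun n => hfun n)
    (s := Nat.factoredNumbers l.primeFactors)).1 h2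
  refine le_trans (le_of_eq ?_) (sum_le_hasSum (S.image (fun n => n / l)) ?_ h4)
  · apply Finset.sum_congr rfl
    intro m hm
    rw [Set.indicator_of_mem]
    obtain ⟨n, hn, rfl⟩ := Finset.mem_image.1 hm
    rw [Nat.mem_factoredNumbers_iff_primeFactors_subset]
    obtain ⟨hn0, hnl⟩ := hS n hn
    have hq : n / l ≠ 0 := by
      have := Nat.mul_div_cancel' (hdvd n hn)
      intro h; rw [h] at this; simp at this; exact hn0 this.symm
    refine ⟨hq, ?_⟩
    have : l.primeFactors = n.primeFactors := by
      rw [← hnl]; exact Nat.primeFactors_prod_primeFactors n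
    rw [this]
    exact Nat.primeFactors_mono (Nat.div_dvd_of_dvd (hdvd n hn)) hn0
  · intro m _
    exact Set.indicator_nonneg (fun n _ => hfun_nonneg n) m

lemma triple_card (n : ℕ) (hn : n ≠ 0) : ∀ S : Finset (ℕ × ℕ × ℕ),
    (∀ t ∈ S, t.1 * t.2.1 * t.2.2 = n) → S.card ≤ 3 ^ (Ω n) := by
  classical
  induction n using induction_on_primes with
  | zero => exact absurd rfl hn
  | one =>
    intro S hS
    have : S ⊆ {(1, 1, 1)} := by
      intro t ht
      have h := hS t ht
      have h1 := mul_eq_one.1 h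
      have h2 := mul_eq_one.1 h1.1
      simp only [mem_singleton]
      exact Prod.ext h2.1 (Prod.ext h2.2 h1.2)
    simpa using Finset.card_le_card this
  | prime_mul p n hp ih =>
    intro S hS
    have hn0 : n ≠ 0 := by rintro rfl; simp at hn
    have ih := ih hn0
    rw [ArithmeticFunction.cardFactors_mul hp.ne_zero hn0,
      ArithmeticFunction.cardFactors_apply_prime hp, pow_add, pow_one]
    have hpp := hp.pos
    have hcov : S ⊆ S.filter (fun t => p ∣ t.1) ∪ S.filter (fun t => p ∣ t.2.1)
        ∪ S.filter (fun t => p ∣ t.2.2) := by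
      intro t ht
      have h : p ∣ t.1 * t.2.1 * t.2.2 := by rw [hS t ht]; exact Dvd.intro _ rfl
      rw [hp.dvd_mul, hp.dvd_mul] at h
      simp only [mem_union, mem_filter, ht, true_and]
      exact h
    have c1 : (S.filter (fun t => p ∣ t.1)).card ≤ 3 ^ (Ω n) := by
      rw [← Finset.card_image_of_injOn (f := fun t : ℕ × ℕ × ℕ => (t.1 / p, t.2.1, t.2.2))]
      · apply ih
        intro t ht
        obtain ⟨⟨a, b, c⟩, hs, rfl⟩ := Finset.mem_image.1 ht
        obtain ⟨hs, k, rfl⟩ := by simpa using hs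
        have := hS _ hs
        simp only [Nat.mul_div_cancel_left k hpp] at this ⊢
        exact Nat.eq_of_mul_eq_mul_left hpp (by rw [← this]; ring)
      · rintro ⟨a, b, c⟩ hs ⟨a', b', c'⟩ hs' h
        obtain ⟨hs, k, rfl⟩ := by simpa using hs
        obtain ⟨hs', k', rfl⟩ := by simpa using hs'
        simp only [Nat.mul_div_cancel_left _ hpp, Prod.mk.injEq] at h ⊢
        simp [h]
    have c2 : (S.filter (fun t => p ∣ t.2.1)).card ≤ 3 ^ (Ω n) := by
      rw [← Finset.card_image_of_injOn (f := fun t : ℕ × ℕ × ℕ => (t.1, t.2.1 / p, t.2.2))]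
      · apply ih
        intro t ht
        obtain ⟨⟨a, b, c⟩, hs, rfl⟩ := Finset.mem_image.1 ht
        obtain ⟨hs, k, rfl⟩ := by simpa using hs
        have := hS _ hs
        simp only [Nat.mul_div_cancel_left k hpp] at this ⊢
        exact Nat.eq_of_mul_eq_mul_left hpp (by rw [← this]; ring)
      · rintro ⟨a, b, c⟩ hs ⟨a', b', c'⟩ hs' h
        obtain ⟨hs, k, rfl⟩ := by simpa using hs
        obtain ⟨hs', k', rfl⟩ := by simpa using hs'
        simp only [Nat.mul_div_cancel_left _ hpp, Prod.mk.injEq] at h ⊢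
        simp [h]
    have c3 : (S.filter (fun t => p ∣ t.2.2)).card ≤ 3 ^ (Ω n) := by
      rw [← Finset.card_image_of_injOn (f := fun t : ℕ × ℕ × ℕ => (t.1, t.2.1, t.2.2 / p))]
      · apply ih
        intro t ht
        obtain ⟨⟨a, b, c⟩, hs, rfl⟩ := Finset.mem_image.1 ht
        obtain ⟨hs, k, rfl⟩ := by simpa using hs
        have := hS _ hs
        simp only [Nat.mul_div_cancel_left k hpp] at this ⊢
        exact Nat.eq_of_mul_eq_mul_left hpp (by rw [← this]; ring)
      · rintro ⟨a, b, c⟩ hs ⟨a', b', c'⟩ hs' h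
        obtain ⟨hs, k, rfl⟩ := by simpa using hs
        obtain ⟨hs', k', rfl⟩ := by simpa using hs'
        simp only [Nat.mul_div_cancel_left _ hpp, Prod.mk.injEq] at h ⊢
        simp [h]
    have := Finset.card_le_card hcov
    have u1 := Finset.card_union_le (S.filter (fun t => p ∣ t.1) ∪ S.filter (fun t => p ∣ t.2.1))
      (S.filter (fun t => p ∣ t.2.2))
    have u2 := Finset.card_union_le (S.filter (fun t => p ∣ t.1)) (S.filter (fun t => p ∣ t.2.1))
    omega

/-- Integers in `[1, y]` not divisible by any member of `T`. -/
def goodSet (T : Finset ℕ) (y : ℕ) : Finset ℕ := (Finset.Icc 1 y).filter (fun a => ∀ t ∈ T, ¬ t ∣ a)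

lemma goodSet_insert (T : Finset ℕ) (t y : ℕ) (ht : 2 ≤ t) :
    (1 / 2 : ℝ) * ∑ a ∈ goodSet T y, (1 : ℝ) / a ≤ ∑ a ∈ goodSet (insert t T) y, (1 : ℝ) / a := by
  classical
  have h1 : ∑ a ∈ goodSet T y, (1 : ℝ) / a = ∑ a ∈ goodSet (insert t T) y, (1 : ℝ) / a
      + ∑ a ∈ (goodSet T y).filter (fun a => t ∣ a), (1 : ℝ) / a := by
    rw [← Finset.sum_filter_add_sum_filter_not (goodSet T y) (fun a => ¬ t ∣ a)]
    congr 1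
    · apply Finset.sum_congr _ (fun _ _ => rfl)
      ext a
      simp only [goodSet, mem_filter, mem_Icc, Finset.forall_mem_insert]
      tauto
    · simp
  have h2 : ∑ a ∈ (goodSet T y).filter (fun a => t ∣ a), (1 : ℝ) / a ≤
      (1 / 2) * ∑ a ∈ goodSet T y, (1 : ℝ) / a := by
    have : ∑ a ∈ (goodSet T y).filter (fun a => t ∣ a), (1 : ℝ) / a =
        ∑ b ∈ ((goodSet T y).filter (fun a => t ∣ a)).image (fun a => a / t), (1 : ℝ) / (t * b) := by
      rw [Finset.sum_image]
      · apply Finset.sum_congr rfl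
        intro a ha
        rw [← Nat.cast_mul, Nat.mul_div_cancel' (mem_filter.1 ha).2]
      · intro a ha b hb hab
        have hab' : a / t = b / t := hab
        rw [← Nat.mul_div_cancel' (mem_filter.1 ha).2, ← Nat.mul_div_cancel' (mem_filter.1 hb).2, hab']
    rw [this, Finset.mul_sum]
    have hsub : ((goodSet T y).filter (fun a => t ∣ a)).image (fun a => a / t) ⊆ goodSet T y := by
      intro b hb
      obtain ⟨a, ha, rfl⟩ := Finset.mem_image.1 hb
      simp only [goodSet, mem_filter, mem_Icc] at ha ⊢
      obtain ⟨⟨⟨h1, h2⟩, h3⟩, k, rfl⟩ := ha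
      rw [Nat.mul_div_cancel_left k (by omega)]
      refine ⟨⟨?_, ?_⟩, ?_⟩
      · rcases Nat.eq_zero_or_pos k with rfl | h
        · simp at h1
        · exact h
      · nlinarith
      · intro s hs h; exact h3 s hs (Dvd.dvd.mul_left h t)
    calc _ ≤ ∑ b ∈ goodSet T y, (1 : ℝ) / (t * b) :=
          Finset.sum_le_sum_of_subset_of_nonneg hsub fun _ _ _ => by positivity
      _ ≤ _ := by
          apply Finset.sum_le_sum
          intro b hb
          simp only [goodSet, mem_filter, mem_Icc] at hb
          have hb1 : (0 : ℝ) < b := by exact_mod_cast hb.1.1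
          have ht' : (2 : ℝ) ≤ t := by exact_mod_cast ht
          rw [div_mul_div_comm, one_mul]
          gcongr
  linarith

lemma goodSet_log (e y : ℕ) (he : 2 ≤ e) :
    Real.log (y + 1) / 16 ≤ ∑ a ∈ goodSet {2, 3, 7, e} y, (1 : ℝ) / a := by
  have h0 : Real.log (y + 1) ≤ ∑ a ∈ goodSet ∅ y, (1 : ℝ) / a := by
    have := log_add_one_le_harmonic y
    rw [harmonic_eq_sum_Icc] at this
    push_cast at this
    simpa [goodSet] using this
  have h1 := goodSet_insert ∅ e y he
  have h2 := goodSet_insert (insert e ∅) 7 y (by norm_num)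
  have h3 := goodSet_insert (insert 7 (insert e ∅)) 3 y (by norm_num)
  have h4 := goodSet_insert (insert 3 (insert 7 (insert e ∅))) 2 y (by norm_num)
  change _ ≤ ∑ a ∈ goodSet (insert 2 (insert 3 (insert 7 (insert e ∅)))) y, (1 : ℝ) / a
  linarith

lemma goodSet_cube (T : Finset ℕ) (hT : ∀ t ∈ T, t.Prime) (h2 : 2 ∈ T) (h3 : 3 ∈ T) (y : ℕ) :
    (∑ a ∈ goodSet T y, (1 : ℝ) / a) ^ 3 ≤ ∑ n ∈ goodSet T (y ^ 3), hfun n := by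
  classical
  have e1 : (∑ a ∈ goodSet T y, (1 : ℝ) / a) ^ 3 =
      ∑ t ∈ goodSet T y ×ˢ goodSet T y ×ˢ goodSet T y, (1 : ℝ) / (t.1 * t.2.1 * t.2.2 : ℕ) := by
    rw [pow_succ, sq, Finset.sum_mul_sum, Finset.sum_product]
    simp_rw [Finset.sum_product, Finset.sum_mul, Finset.mul_sum]
    apply Finset.sum_congr rfl
    intro a _
    apply Finset.sum_congr rfl
    intro b _
    apply Finset.sum_congr rfl
    intro c _
    push_cast
    rw [div_mul_div_comm, div_mul_div_comm]; simp
  have hmaps : ∀ t ∈ goodSet T y ×ˢ goodSet T y ×ˢ goodSet T y,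
      t.1 * t.2.1 * t.2.2 ∈ goodSet T (y ^ 3) := by
    rintro ⟨a, b, c⟩ ht
    simp only [mem_product, goodSet, mem_filter, mem_Icc] at ht ⊢
    obtain ⟨⟨⟨a1, a2⟩, a3⟩, ⟨⟨b1, b2⟩, b3⟩, ⟨c1, c2⟩, c3⟩ := ht
    refine ⟨⟨?_, ?_⟩, ?_⟩
    · exact Nat.mul_pos (Nat.mul_pos a1 b1) c1
    · calc a * b * c ≤ y * y * y := by gcongr
        _ = y ^ 3 := by ring
    · intro t ht h
      have hp := hT t ht
      rw [hp.dvd_mul, hp.dvd_mul] at h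
      rcases h with (h | h) | h
      exacts [a3 t ht h, b3 t ht h, c3 t ht h]
  rw [e1, ← Finset.sum_fiberwise_of_maps_to hmaps]
  apply Finset.sum_le_sum
  intro n hn
  simp only [goodSet, mem_filter, mem_Icc] at hn
  have hn0 : n ≠ 0 := by omega
  have hc6 : Nat.Coprime n 6 := by
    have a : Nat.Coprime n 2 := ((Nat.Prime.coprime_iff_not_dvd Nat.prime_two).2 (hn.2 2 h2)).symm
    have b : Nat.Coprime n 3 := ((Nat.Prime.coprime_iff_not_dvd Nat.prime_three).2 (hn.2 3 h3)).symm
    exact Nat.Coprime.mul_right a b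
  rw [hfun_apply hc6]
  have : ∀ t ∈ (goodSet T y ×ˢ goodSet T y ×ˢ goodSet T y).filter
      (fun t => t.1 * t.2.1 * t.2.2 = n), (1 : ℝ) / (t.1 * t.2.1 * t.2.2 : ℕ) = 1 / n := by
    intro t ht
    rw [(mem_filter.1 ht).2]
  rw [Finset.sum_congr rfl this, Finset.sum_const, nsmul_eq_mul, mul_one_div]
  have hc := triple_card n hn0 ((goodSet T y ×ˢ goodSet T y ×ˢ goodSet T y).filter
      (fun t => t.1 * t.2.1 * t.2.2 = n)) (fun t ht => (mem_filter.1 ht).2)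
  have hc' : (((goodSet T y ×ˢ goodSet T y ×ˢ goodSet T y).filter
      (fun t => t.1 * t.2.1 * t.2.2 = n)).card : ℝ) ≤ 3 ^ (Ω n) := by exact_mod_cast hc
  gcongr

/-- The primes up to `D` outside `T`. -/
def sievePrimes (T : Finset ℕ) (D : ℕ) : Finset ℕ :=
  (Finset.Icc 1 D).filter (fun p => p.Prime ∧ p ∉ T)

lemma sievePrimes_prime {T : Finset ℕ} {D p : ℕ} (h : p ∈ sievePrimes T D) : p.Prime :=
  (mem_filter.1 h).2.1

lemma sievePrimes_squarefree (T : Finset ℕ) (D : ℕ) : Squarefree (∏ p ∈ sievePrimes T D, p) := by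
  apply Finset.squarefree_prod_of_pairwise_isCoprime
  · intro p hp q hq hpq
    exact Nat.coprime_iff_isRelPrime.1
      ((Nat.coprime_primes (sievePrimes_prime hp) (sievePrimes_prime hq)).2 hpq)
  · intro p hp
    exact (sievePrimes_prime hp).squarefree

lemma prime_dvd_sieveProd {T : Finset ℕ} {D p : ℕ} (hp : p.Prime) :
    p ∣ (∏ p ∈ sievePrimes T D, p) ↔ p ∈ sievePrimes T D := by
  constructor
  · intro h
    obtain ⟨q, hq, hpq⟩ := (Prime.dvd_finsetProd_iff hp.prime _).1 h
    rwa [(Nat.prime_dvd_prime_iff_eq hp (sievePrimes_prime hq)).1 hpq]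
  · intro h; exact Finset.dvd_prod_of_mem _ h

lemma sieve_L_lower (s : BoundingSieve) (T : Finset ℕ) (h2 : 2 ∈ T) (h3 : 3 ∈ T) (D : ℕ)
    (hP : s.prodPrimes = ∏ p ∈ sievePrimes T D, p)
    (hnu : ∀ p ∈ sievePrimes T D, s.nu p = 3 / p) :
    ∑ n ∈ goodSet T D, hfun n ≤
      ∑ l ∈ s.prodPrimes.divisors with l ≤ D, s.selbergTerms l := by
  classical
  have hmaps : ∀ n ∈ goodSet T D, (∏ p ∈ n.primeFactors, p) ∈
      s.prodPrimes.divisors.filter (· ≤ D) := by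
    intro n hn
    simp only [goodSet, mem_filter, mem_Icc] at hn
    have hle : ∏ p ∈ n.primeFactors, p ≤ n := Nat.le_of_dvd (by omega) (Nat.prod_primeFactors_dvd n)
    simp only [mem_filter, Nat.mem_divisors]
    refine ⟨⟨?_, s.prodPrimes_squarefree.ne_zero⟩, by omega⟩
    rw [hP]
    apply Finset.prod_dvd_prod_of_subset
    intro p hp
    have hpp := Nat.prime_of_mem_primeFactors hp
    have hpd := Nat.dvd_of_mem_primeFactors hp
    simp only [sievePrimes, mem_filter, mem_Icc]
    refine ⟨⟨hpp.pos, (Nat.le_of_dvd (by omega) hpd).trans hn.1.2⟩, hpp, ?_⟩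
    intro h; exact hn.2 p h hpd
  rw [← Finset.sum_fiberwise_of_maps_to hmaps]
  apply Finset.sum_le_sum
  intro l hl
  simp only [mem_filter, Nat.mem_divisors] at hl
  have hlsq : Squarefree l := s.prodPrimes_squarefree.squarefree_of_dvd hl.1.1
  refine (fiber_bound l hlsq _ ?_).trans (le_of_eq ?_)
  · intro n hn
    simp only [goodSet, mem_filter, mem_Icc] at hn
    exact ⟨by omega, hn.2⟩
  · have hh : ∀ p ∈ l.primeFactors, hfun p = s.nu p := by
      intro p hp
      have hpp := Nat.prime_of_mem_primeFactors hp
      have hpd := (Nat.dvd_of_mem_primeFactors hp).trans hl.1.1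
      rw [hP, prime_dvd_sieveProd hpp] at hpd
      rw [hnu p hpd, hfun_prime hpp]
      · rintro rfl; exact (mem_filter.1 hpd).2.2 h2
      · rintro rfl; exact (mem_filter.1 hpd).2.2 h3
    rw [BoundingSieve.selbergTerms_apply, ← BoundingSieve.prod_primeFactors_nu hl.1.1]
    congr 1
    · conv_lhs => rw [← Nat.prod_primeFactors_of_squarefree hlsq, map_prod]
      exact Finset.prod_congr rfl hh
    · exact Finset.prod_congr rfl fun p hp => by rw [hh p hp]

end LowerBound

section Classes

/-- On `n ≥ 3` the predicate `S` is a union of `k` residue classes modulo `m`. -/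
def HasClasses (S : ℕ → Prop) (m k : ℕ) : Prop :=
  ∃ R : Finset ℕ, R ⊆ Finset.range m ∧ R.card = k ∧ ∀ n, 3 ≤ n → (S n ↔ n % m ∈ R)

lemma HasClasses.and {S₁ S₂ : ℕ → Prop} {m₁ m₂ k₁ k₂ : ℕ} (h₁ : HasClasses S₁ m₁ k₁)
    (h₂ : HasClasses S₂ m₂ k₂) (hm₁ : m₁ ≠ 0) (hm₂ : m₂ ≠ 0) (hc : Nat.Coprime m₁ m₂) :
    HasClasses (fun n => S₁ n ∧ S₂ n) (m₁ * m₂) (k₁ * k₂) := by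
  classical
  obtain ⟨R₁, hR₁, rfl, h₁⟩ := h₁
  obtain ⟨R₂, hR₂, rfl, h₂⟩ := h₂
  refine ⟨(Finset.range (m₁ * m₂)).filter (fun n => n % m₁ ∈ R₁ ∧ n % m₂ ∈ R₂),
    Finset.filter_subset _ _, ?_, ?_⟩
  · rw [← Finset.card_product]
    apply Finset.card_nbij (fun n => (n % m₁, n % m₂))
    · intro n hn
      have hn := (mem_filter.1 hn).2
      exact mem_product.2 hn
    · intro a ha b hb hab
      have ha := mem_range.1 (mem_filter.1 ha).1
      have hb := mem_range.1 (mem_filter.1 hb).1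
      simp only [Prod.mk.injEq] at hab
      have : a ≡ b [MOD m₁ * m₂] := (Nat.modEq_and_modEq_iff_modEq_mul hc).1 hab
      have h : a % (m₁ * m₂) = b % (m₁ * m₂) := this
      rwa [Nat.mod_eq_of_lt ha, Nat.mod_eq_of_lt hb] at h
    · rintro ⟨a, b⟩ hab
      obtain ⟨ha, hb⟩ := mem_product.1 hab
      have ha' := mem_range.1 (hR₁ ha)
      have hb' := mem_range.1 (hR₂ hb)
      let z := Nat.chineseRemainder hc a b
      have hz1 : z.1 % m₁ = a := by
        have : z.1 % m₁ = a % m₁ := z.2.1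
        rw [this, Nat.mod_eq_of_lt ha']
      have hz2 : z.1 % m₂ = b := by
        have : z.1 % m₂ = b % m₂ := z.2.2
        rw [this, Nat.mod_eq_of_lt hb']
      refine ⟨z.1, ?_, ?_⟩
      · simp only [coe_filter, Set.mem_ofPred_eq, mem_range]
        refine ⟨Nat.chineseRemainder_lt_mul hc a b hm₁ hm₂, ?_, ?_⟩
        · rw [hz1]; exact ha
        · rw [hz2]; exact hb
      · simp only [hz1, hz2]
  · intro n hn
    simp only [mem_filter, mem_range]
    rw [h₁ n hn, h₂ n hn, Nat.mod_mul_right_mod, Nat.mod_mul_left_mod]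
    have : n % (m₁ * m₂) < m₁ * m₂ := Nat.mod_lt _ (Nat.pos_of_ne_zero (Nat.mul_ne_zero hm₁ hm₂))
    tauto

lemma count_class (X : ℝ) (hX : 3 ≤ X) (m c : ℕ) (hm : 0 < m) (hc : c < m) :
    |(((Finset.Icc 3 ⌊X⌋₊).filter (fun n => n % m = c)).card : ℝ) - X / m| ≤ 4 := by
  classical
  set N := ⌊X⌋₊
  have hN1 : (N : ℝ) ≤ X := Nat.floor_le (by linarith)
  have hN2 : X < N + 1 := Nat.lt_floor_add_one X
  have h1 := Nat.count_modEq_card (N + 1) hm c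
  rw [Nat.count_eq_card_filter_range] at h1
  have hpred : (Finset.range (N + 1)).filter (fun n => n ≡ c [MOD m]) =
      (Finset.range (N + 1)).filter (fun n => n % m = c) := by
    apply Finset.filter_congr
    intro n _
    simp [Nat.ModEq, Nat.mod_eq_of_lt hc]
  rw [hpred] at h1
  have hle1 : ((Finset.Icc 3 N).filter (fun n => n % m = c)).card ≤
      ((Finset.range (N + 1)).filter (fun n => n % m = c)).card := by
    apply Finset.card_le_card
    intro n hn
    simp only [mem_filter, mem_Icc, mem_range] at hn ⊢
    exact ⟨by omega, hn.2⟩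
  have hle2 : ((Finset.range (N + 1)).filter (fun n => n % m = c)).card ≤
      3 + ((Finset.Icc 3 N).filter (fun n => n % m = c)).card := by
    have : (Finset.range (N + 1)).filter (fun n => n % m = c) ⊆
        Finset.range 3 ∪ (Finset.Icc 3 N).filter (fun n => n % m = c) := by
      intro n hn
      simp only [mem_filter, mem_Icc, mem_range, mem_union] at hn ⊢
      by_cases h : n < 3
      · exact Or.inl h
      · exact Or.inr ⟨by omega, hn.2⟩
    exact (Finset.card_le_card this).trans ((Finset.card_union_le _ _).trans (by simp))
  have hdiv1 : (((N + 1) / m : ℕ) : ℝ) ≤ ((N : ℝ) + 1) / m := by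
    have := @Nat.cast_div_le ℝ _ _ _ (N + 1) m
    push_cast at this; exact this
  have hm' : (1 : ℝ) ≤ m := by exact_mod_cast hm
  have hdiv2 : ((N : ℝ) + 1) / m < (((N + 1) / m : ℕ) : ℝ) + 1 := by
    rw [div_lt_iff₀ (by linarith)]
    have := Nat.lt_mul_div_succ (N + 1) hm
    have h' : ((N + 1 : ℕ) : ℝ) < ((m * ((N + 1) / m + 1) : ℕ) : ℝ) := by exact_mod_cast this
    push_cast at h' ⊢
    linarith
  have hX1 : X / m ≤ ((N : ℝ) + 1) / m := by gcongr
  have hX2 : ((N : ℝ) + 1) / m ≤ X / m + 1 := by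
    rw [div_add_one (by linarith)]
    gcongr
    
  have b1 : (N + 1) / m ≤ ((Finset.range (N + 1)).filter (fun n => n % m = c)).card := by
    rw [h1]; omega
  have b2 : ((Finset.range (N + 1)).filter (fun n => n % m = c)).card ≤ (N + 1) / m + 1 := by
    rw [h1]; split_ifs <;> omega
  have b1' : (((N + 1) / m : ℕ) : ℝ) ≤ 3 + ((Finset.Icc 3 N).filter (fun n => n % m = c)).card := by
    exact_mod_cast b1.trans hle2
  have b2' : (((Finset.Icc 3 N).filter (fun n => n % m = c)).card : ℝ) ≤ (((N + 1) / m : ℕ) : ℝ) + 1 := by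
    exact_mod_cast hle1.trans b2
  rw [abs_le]
  constructor <;> linarith

lemma HasClasses.count {S : ℕ → Prop} [DecidablePred S] {m k : ℕ} (h : HasClasses S m k) (hm : 0 < m) (X : ℝ)
    (hX : 3 ≤ X) :
    |(((Finset.Icc 3 ⌊X⌋₊).filter S).card : ℝ) - k * (X / m)| ≤ 4 * k := by
  classical
  obtain ⟨R, hR, rfl, h⟩ := h
  have hmaps : ∀ n ∈ (Finset.Icc 3 ⌊X⌋₊).filter S, n % m ∈ R := by
    intro n hn
    simp only [mem_filter, mem_Icc] at hn
    exact (h n hn.1.1).1 hn.2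
  rw [Finset.card_eq_sum_card_fiberwise hmaps]
  have he : ∀ c ∈ R, ((Finset.Icc 3 ⌊X⌋₊).filter S).filter (fun n => n % m = c) =
      (Finset.Icc 3 ⌊X⌋₊).filter (fun n => n % m = c) := by
    intro c hc
    ext n
    simp only [mem_filter, mem_Icc]
    constructor
    · rintro ⟨⟨a, _⟩, b⟩; exact ⟨a, b⟩
    · rintro ⟨a, b⟩; exact ⟨⟨a, (h n a.1).2 (b ▸ hc)⟩, b⟩
  rw [Finset.sum_congr rfl (fun c hc => by rw [he c hc])]
  push_cast
  have : (R.card : ℝ) * (X / m) = ∑ c ∈ R, X / m := by simp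
  rw [this, ← Finset.sum_sub_distrib]
  refine (Finset.abs_sum_le_sum_abs _ _).trans ?_
  calc _ ≤ ∑ c ∈ R, (4 : ℝ) := Finset.sum_le_sum fun c hc =>
        count_class X hX m c hm (mem_range.1 (hR hc))
    _ = _ := by simp [mul_comm]

/-- The product of the three linear forms. -/
def ff (n : ℕ) : ℕ := n * (2 * n - 3) * (3 * n - 8)

lemma ff_cast {R : Type*} [CommRing R] (n : ℕ) (hn : 3 ≤ n) :
    ((ff n : ℕ) : R) = (n : R) * (2 * n - 3) * (3 * n - 8) := by
  unfold ff
  push_cast [Nat.cast_sub (show 3 ≤ 2 * n by omega), Nat.cast_sub (show 8 ≤ 3 * n by omega)]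
  ring

lemma ff_inj : Set.InjOn ff {n | 3 ≤ n} := by
  apply StrictMonoOn.injOn
  intro a ha b hb hab
  simp only [Set.mem_ofPred_eq] at ha hb
  unfold ff
  have h1 : 2 * a - 3 < 2 * b - 3 := by omega
  have h2 : 3 * a - 8 < 3 * b - 8 := by omega
  exact Nat.mul_lt_mul'' (Nat.mul_lt_mul'' hab h1) h2

lemma classes_prime (r : ℕ) (hr : r.Prime) (h2 : r ≠ 2) (h3 : r ≠ 3) (h7 : r ≠ 7) :
    HasClasses (fun n => r ∣ ff n) r 3 := by
  classical
  have := Fact.mk hr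
  have key : ∀ p : ℕ, p.Prime → r ≠ p → ((p : ℕ) : ZMod r) ≠ 0 := by
    intro p hp hne h
    rw [ZMod.natCast_eq_zero_iff] at h
    exact hne ((Nat.prime_dvd_prime_iff_eq hr hp).1 h)
  have k2 : (2 : ZMod r) ≠ 0 := by exact_mod_cast key 2 Nat.prime_two h2
  have k3 : (3 : ZMod r) ≠ 0 := by exact_mod_cast key 3 Nat.prime_three h3
  have k7 : (7 : ZMod r) ≠ 0 := by exact_mod_cast key 7 (by norm_num) h7
  have e1 : (0 : ZMod r) ≠ 3 / 2 := (div_ne_zero k3 k2).symm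
  have k8 : (8 : ZMod r) ≠ 0 := by
    have : (8 : ZMod r) = 2 ^ 3 := by norm_num
    rw [this]; exact pow_ne_zero _ k2
  have e2 : (0 : ZMod r) ≠ 8 / 3 := (div_ne_zero k8 k3).symm
  have e3 : (3 / 2 : ZMod r) ≠ 8 / 3 := by
    intro h
    rw [div_eq_div_iff k2 k3] at h
    apply k7
    linear_combination -h
  refine ⟨({0, 3 / 2, 8 / 3} : Finset (ZMod r)).image ZMod.val, ?_, ?_, ?_⟩
  · intro x hx
    obtain ⟨y, _, rfl⟩ := Finset.mem_image.1 hx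
    exact mem_range.2 (ZMod.val_lt y)
  · rw [Finset.card_image_of_injective _ (ZMod.val_injective r)]
    rw [Finset.card_eq_three]
    exact ⟨0, 3 / 2, 8 / 3, e1, e2, e3, rfl⟩
  · intro n hn
    change r ∣ ff n ↔ _
    rw [← ZMod.natCast_eq_zero_iff, ff_cast n hn, ← ZMod.val_natCast,
      (ZMod.val_injective r).mem_finset_image]
    simp only [mem_insert, mem_singleton, mul_eq_zero, or_assoc]
    rw [eq_div_iff k2, eq_div_iff k3, sub_eq_zero, sub_eq_zero, mul_comm (2 : ZMod r), mul_comm (3 : ZMod r)]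

lemma classes_q (q : ℕ) (hq : 0 < q) (h3 : Nat.Coprime 3 q) :
    HasClasses (fun n => q ∣ 3 * n - 8) q 1 := by
  classical
  have : NeZero q := ⟨hq.ne'⟩
  have hinv : ((3 : ℕ) : ZMod q) * ((3 : ℕ) : ZMod q)⁻¹ = 1 := ZMod.coe_mul_inv_eq_one 3 h3
  push_cast at hinv
  refine ⟨{(8 * (3 : ZMod q)⁻¹ : ZMod q).val}, ?_, by simp, ?_⟩
  · intro x hx
    rw [mem_singleton.1 hx]
    exact mem_range.2 (ZMod.val_lt _)
  · intro n hn
    change q ∣ 3 * n - 8 ↔ _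
    rw [← ZMod.natCast_eq_zero_iff, ← ZMod.val_natCast, mem_singleton,
      (ZMod.val_injective q).eq_iff]
    push_cast [Nat.cast_sub (show 8 ≤ 3 * n by omega)]
    constructor
    · intro h
      linear_combination (3 : ZMod q)⁻¹ * h - (n : ZMod q) * hinv
    · intro h
      linear_combination 3 * h + 8 * hinv

lemma classes_prod (T : Finset ℕ) (D q : ℕ) (hq : 0 < q) (h3 : Nat.Coprime 3 q)
    (h2T : 2 ∈ T) (h3T : 3 ∈ T) (h7T : 7 ∈ T)
    (hqT : ∀ r, r.Prime → r ∉ T → Nat.Coprime q r) (U : Finset ℕ) (hU : U ⊆ sievePrimes T D) :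
    HasClasses (fun n => q ∣ 3 * n - 8 ∧ (∏ p ∈ U, p) ∣ ff n) (q * ∏ p ∈ U, p) (3 ^ U.card) := by
  classical
  induction U using Finset.induction_on with
  | empty => simpa using classes_q q hq h3
  | insert r U hr ih =>
    have hrS := hU (mem_insert_self r U)
    have hUS : U ⊆ sievePrimes T D := (Finset.subset_insert r U).trans hU
    have ih := ih hUS
    have hrp := sievePrimes_prime hrS
    have hrT : r ∉ T := (mem_filter.1 hrS).2.2
    have hcU : Nat.Coprime (∏ p ∈ U, p) r := by
      apply Nat.Coprime.prod_left
      intro p hp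
      rw [Nat.coprime_primes (sievePrimes_prime (hUS hp)) hrp]
      rintro rfl; exact hr hp
    have hU0 : (∏ p ∈ U, p) ≠ 0 := Finset.prod_ne_zero_iff.2 fun p hp =>
      (sievePrimes_prime (hUS hp)).ne_zero
    have hr3 := classes_prime r hrp (by rintro rfl; exact hrT h2T) (by rintro rfl; exact hrT h3T)
      (by rintro rfl; exact hrT h7T)
    have := ih.and hr3 (Nat.mul_ne_zero hq.ne' hU0) hrp.ne_zero
      (Nat.Coprime.mul_left (hqT r hrp hrT) hcU)
    rw [Finset.prod_insert hr, Finset.card_insert_of_notMem hr, pow_succ, mul_comm r, ← mul_assoc]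
    convert this using 2 with n
    rw [and_assoc]
    apply and_congr_right
    intro _
    constructor
    · intro h; exact ⟨(Dvd.intro _ rfl).trans h, (Dvd.intro_left _ rfl).trans h⟩
    · rintro ⟨a, b⟩; exact Nat.Coprime.mul_dvd_of_dvd_of_dvd hcU a b

end Classes

section Application

/-- The sieve problem attached to `X`, modulus `q` and excluded prime `e`. -/
noncomputable def theSieve (X : ℝ) (q e D : ℕ) : BoundingSieve where
  support := ((Finset.Icc 3 ⌊X⌋₊).filter (fun n => q ∣ 3 * n - 8)).image ff
  prodPrimes := ∏ p ∈ sievePrimes {2, 3, 7, e} D, p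
  prodPrimes_squarefree := sievePrimes_squarefree _ _
  weights := fun _ => 1
  weights_nonneg := fun _ => zero_le_one
  totalMass := X / q
  nu := ArithmeticFunction.prodPrimeFactors (fun p => (3 : ℝ) / p)
  nu_mult := ArithmeticFunction.IsMultiplicative.prodPrimeFactors _
  nu_pos_of_prime := by
    intro p hp _
    rw [ArithmeticFunction.prodPrimeFactors_apply hp.ne_zero, hp.primeFactors, Finset.prod_singleton]
    have : (0 : ℝ) < p := by exact_mod_cast hp.pos
    positivity
  nu_lt_one_of_prime := by
    intro p hp hpd
    rw [prime_dvd_sieveProd hp] at hpd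
    have hpT := (mem_filter.1 hpd).2.2
    rw [ArithmeticFunction.prodPrimeFactors_apply hp.ne_zero, hp.primeFactors, Finset.prod_singleton]
    have : (0 : ℝ) < p := by exact_mod_cast hp.pos
    rw [div_lt_one this]
    have h2 : p ≠ 2 := by rintro rfl; simp at hpT
    have h3 : p ≠ 3 := by rintro rfl; simp at hpT
    have := hp.two_le
    have : 3 < p := by omega
    exact_mod_cast this

open Classical in
/-- The sifted set: `n ≤ X` with `q ∣ 3 * n - 8` and no prime factor `≤ y^3` of the three forms,
  apart from `2, 3, 7, e`. -/
noncomputable def sifted (X : ℝ) (q e y : ℕ) : Finset ℕ :=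
  (Finset.Icc 3 ⌊X⌋₊).filter (fun n => q ∣ 3 * n - 8 ∧
      ∀ r, r.Prime → r ≤ y ^ 3 → r ≠ 2 → r ≠ 3 → r ≠ 7 → r ≠ e → ¬ r ∣ ff n)

open BoundingSieve in
theorem sieve_bound (X : ℝ) (hX : 3 ≤ X) (q e y : ℕ) (hy : 1 ≤ y) (hq : 0 < q) (h3 : Nat.Coprime 3 q)
    (he : e.Prime) (hqe : ∀ r, r.Prime → r ≠ e → Nat.Coprime q r) :
    ((sifted X q e y).card : ℝ) ≤
      X / q / (Real.log (y + 1) / 16) ^ 3 + 4 * (y : ℝ) ^ 12 := by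
  classical
  set D := y ^ 3 with hD
  set T : Finset ℕ := {2, 3, 7, e} with hT
  set s := theSieve X q e D with hs
  set A := (Finset.Icc 3 ⌊X⌋₊).filter (fun n => q ∣ 3 * n - 8) with hA
  have hPs : s.prodPrimes = ∏ p ∈ sievePrimes T D, p := rfl
  have hnuapp : ∀ d, d ≠ 0 → s.nu d = ∏ p ∈ d.primeFactors, (3 : ℝ) / p := fun d hd =>
    ArithmeticFunction.prodPrimeFactors_apply hd
  have hinj : Set.InjOn ff (A : Set ℕ) := by
    apply ff_inj.mono
    intro n hn
    have hn : n ∈ A := hn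
    simp only [hA, mem_filter, mem_Icc] at hn
    exact hn.1.1
  have hPne : s.prodPrimes ≠ 0 := s.prodPrimes_squarefree.ne_zero
  have hnud : ∀ d, d ∣ s.prodPrimes → s.nu d * d = 3 ^ d.primeFactors.card := by
    intro d hd
    have hsq := s.prodPrimes_squarefree.squarefree_of_dvd hd
    rw [hnuapp d hsq.ne_zero, Finset.prod_div_distrib, Finset.prod_const]
    have h := Nat.prod_primeFactors_of_squarefree hsq
    have hd0 : (d : ℝ) ≠ 0 := by exact_mod_cast hsq.ne_zero
    rw [← Nat.cast_prod, h]
    field_simp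
  have hsift : ((sifted X q e y).card : ℝ) ≤ s.siftedSum := by
    have : s.siftedSum = ∑ n ∈ A, if Nat.Coprime s.prodPrimes (ff n) then (1 : ℝ) else 0 := by
      unfold siftedSum
      change ∑ d ∈ A.image ff, (if Nat.Coprime s.prodPrimes d then (1 : ℝ) else 0) = _
      rw [Finset.sum_image hinj]
    rw [this, Finset.sum_boole]
    norm_cast
    apply Finset.card_le_card
    intro n hn
    simp only [hA, sifted, mem_filter] at hn ⊢
    refine ⟨⟨hn.1, hn.2.1⟩, ?_⟩
    rw [hPs]
    apply Nat.Coprime.prod_left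
    intro r hr
    rw [(sievePrimes_prime hr).coprime_iff_not_dvd]
    simp only [sievePrimes, hT, mem_filter, mem_Icc, mem_insert, mem_singleton, not_or] at hr
    exact hn.2.2 r hr.2.1 hr.1.2 hr.2.2.1 hr.2.2.2.1 hr.2.2.2.2.1 hr.2.2.2.2.2
  have hrem : ∀ d, d ∣ s.prodPrimes → |s.rem d| ≤ 4 * (3 : ℝ) ^ d.primeFactors.card := by
    intro d hd
    have hsq := s.prodPrimes_squarefree.squarefree_of_dvd hd
    have hsub : d.primeFactors ⊆ sievePrimes T D := by
      intro p hp
      have hpp := Nat.prime_of_mem_primeFactors hp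
      rw [← prime_dvd_sieveProd hpp]
      exact (Nat.dvd_of_mem_primeFactors hp).trans hd
    have hcl := classes_prod T D q hq h3 (by simp [hT]) (by simp [hT]) (by simp [hT])
      (by
        intro r hr hrT
        apply hqe r hr
        rintro rfl
        simp [hT] at hrT) d.primeFactors hsub
    rw [Nat.prod_primeFactors_of_squarefree hsq] at hcl
    have hcount := hcl.count (Nat.mul_pos hq (Nat.pos_of_ne_zero hsq.ne_zero)) X hX
    have hmult : s.multSum d = (((Finset.Icc 3 ⌊X⌋₊).filter
        (fun n => q ∣ 3 * n - 8 ∧ d ∣ ff n)).card : ℝ) := by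
      unfold multSum
      change ∑ m ∈ A.image ff, (if d ∣ m then (1 : ℝ) else 0) = _
      rw [Finset.sum_image hinj, Finset.sum_boole, hA, Finset.filter_filter]
    have hd0 : (d : ℝ) ≠ 0 := by exact_mod_cast hsq.ne_zero
    have hq0 : (q : ℝ) ≠ 0 := by exact_mod_cast hq.ne'
    have hmain : s.nu d * s.totalMass = ((3 ^ d.primeFactors.card : ℕ) : ℝ) * (X / ((q * d : ℕ) : ℝ)) := by
      push_cast
      rw [← hnud d hd]
      change s.nu d * (X / q) = _
      field_simp
    rw [BoundingSieve.rem, hmult, hmain]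
    refine hcount.trans (le_of_eq ?_)
    push_cast; ring
  have hD1 : 1 ≤ D := Nat.one_le_pow _ _ hy
  have hmainb := selberg_crude s D hD1 (fun d => (3 : ℝ) ^ d.primeFactors.card) 4 (by norm_num) hrem
    (by
      intro d₁ d₂ hd₁ hd₂
      rw [← pow_add]
      have n1 := ne_zero_of_dvd_ne_zero hPne hd₁
      have n2 := ne_zero_of_dvd_ne_zero hPne hd₂
      have hsub : (Nat.lcm d₁ d₂).primeFactors ⊆ d₁.primeFactors ∪ d₂.primeFactors := by
        rw [← Nat.primeFactors_mul n1 n2]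
        exact Nat.primeFactors_mono (Nat.lcm_dvd_mul _ _) (Nat.mul_ne_zero n1 n2)
      exact pow_le_pow_right₀ (by norm_num)
        ((Finset.card_le_card hsub).trans (Finset.card_union_le _ _)))
    (by intro d; positivity)
    (by intro d hd; rw [mul_comm, hnud d hd])
  have hlow : (Real.log (y + 1) / 16) ^ 3 ≤
      ∑ l ∈ s.prodPrimes.divisors with l ≤ D, s.selbergTerms l := by
    have h1 := sieve_L_lower s T (by simp [hT]) (by simp [hT]) D hPs (by
      intro p hp
      have hpp := sievePrimes_prime hp
      rw [hnuapp p hpp.ne_zero, hpp.primeFactors, Finset.prod_singleton])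
    have h2 := goodSet_cube T (by
      intro t ht
      simp only [hT, mem_insert, mem_singleton] at ht
      rcases ht with rfl | rfl | rfl | rfl
      · norm_num
      · norm_num
      · norm_num
      · exact he) (by simp [hT]) (by simp [hT]) y
    have h4 := goodSet_log e y he.two_le
    have h5 : 0 ≤ Real.log (y + 1) / 16 := div_nonneg (Real.log_nonneg (by
      have : (0 : ℝ) ≤ y := Nat.cast_nonneg y
      linarith)) (by norm_num)
    exact (pow_le_pow_left₀ h5 h4 3).trans (h2.trans h1)
  have hlogpos : 0 < Real.log (y + 1) := Real.log_pos (by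
    have : (1 : ℝ) ≤ y := by exact_mod_cast hy
    linarith)
  refine hsift.trans (hmainb.trans ?_)
  have htm : s.totalMass = X / q := rfl
  rw [htm]
  have e12 : 4 * (D : ℝ) ^ 4 = 4 * (y : ℝ) ^ 12 := by rw [hD]; push_cast; ring
  rw [e12]
  gcongr

end Application

section Cover

lemma n_prime {n : ℕ} (hn : 10 ≤ n)
    (h : ¬∃ x y z : ℕ, 0 < x ∧ 0 < y ∧ 0 < z ∧ n = x * y * z + x + y + z) : n.Prime := by
  by_contra hp
  obtain ⟨a, b, ha, hb, hab⟩ := (Nat.not_prime_iff_exists_mul_eq (by omega)).1 hp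
  have hb0 : 1 < b := by
    rcases b with _ | _ | b
    · omega
    · omega
    · omega
  have ha0 : 1 < a := by
    rcases a with _ | _ | a
    · simp at hab; omega
    · simp at hab; omega
    · omega
  obtain ⟨x, rfl⟩ : ∃ x, a = x + 1 := ⟨a - 1, by omega⟩
  obtain ⟨y, rfl⟩ : ∃ y, b = y + 1 := ⟨b - 1, by omega⟩
  exact h ⟨x, y, 1, by omega, by omega, by omega, by rw [← hab]; ring⟩

lemma two_n_prime {n : ℕ} (hn : 10 ≤ n)
    (h : ¬∃ x y z : ℕ, 0 < x ∧ 0 < y ∧ 0 < z ∧ n = x * y * z + x + y + z) :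
    (2 * n - 3).Prime := by
  by_contra hp
  obtain ⟨a, b, ha, hb, hab⟩ := (Nat.not_prime_iff_exists_mul_eq (by omega)).1 hp
  have hodd : (a * b) % 2 = 1 := by omega
  have ha2 : a % 2 = 1 := by
    rcases Nat.mod_two_eq_zero_or_one a with h | h
    · rw [Nat.mul_mod, h] at hodd; simp at hodd
    · exact h
  have hb2 : b % 2 = 1 := by
    rcases Nat.mod_two_eq_zero_or_one b with h | h
    · rw [Nat.mul_mod, h] at hodd; simp at hodd
    · exact h
  have ha1 : a ≠ 1 := by rintro rfl; omega
  have hb1 : b ≠ 1 := by rintro rfl; omega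
  obtain ⟨x, rfl⟩ : ∃ x, a = 2 * x + 1 := ⟨a / 2, by omega⟩
  obtain ⟨y, rfl⟩ : ∃ y, b = 2 * y + 1 := ⟨b / 2, by omega⟩
  refine h ⟨x, y, 2, by omega, by omega, by omega, ?_⟩
  have : (2 * x + 1) * (2 * y + 1) = 2 * (x * y * 2 + x + y) + 1 := by ring
  omega

lemma no_fact_three {n : ℕ} (hn : 10 ≤ n)
    (h : ¬∃ x y z : ℕ, 0 < x ∧ 0 < y ∧ 0 < z ∧ n = x * y * z + x + y + z) (a b : ℕ)
    (hab : a * b = 3 * n - 8) (ha : 1 < a) (hb : 1 < b) (ha3 : a % 3 = 1) : False := by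
  have hb3 : b % 3 = 1 := by
    have h1 : (a * b) % 3 = 1 := by omega
    rw [Nat.mul_mod, ha3] at h1
    omega
  obtain ⟨x, rfl⟩ : ∃ x, a = 3 * x + 1 := ⟨a / 3, by omega⟩
  obtain ⟨y, rfl⟩ : ∃ y, b = 3 * y + 1 := ⟨b / 3, by omega⟩
  refine h ⟨x, y, 3, by omega, by omega, by omega, ?_⟩
  have : (3 * x + 1) * (3 * y + 1) = 3 * (x * y * 3 + x + y) + 1 := by ring
  omega

lemma three_n_cases {n : ℕ} (hn : 10 ≤ n)
    (h : ¬∃ x y z : ℕ, 0 < x ∧ 0 < y ∧ 0 < z ∧ n = x * y * z + x + y + z) :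
    (3 * n - 8).Prime ∨ ∃ q k : ℕ, q.Prime ∧ k.Prime ∧ q ≠ 3 ∧ q ≤ k ∧ q * k = 3 * n - 8 := by
  by_cases hp : (3 * n - 8).Prime
  · exact Or.inl hp
  right
  have hm1 : 3 * n - 8 ≠ 1 := by omega
  set m := 3 * n - 8 with hm
  have hm3 : m % 3 = 1 := by omega
  have hq := Nat.minFac_prime hm1
  obtain ⟨k, hk⟩ := Nat.minFac_dvd m
  set q := m.minFac with hqdef
  have hk1 : k ≠ 1 := by
    rintro rfl
    rw [mul_one] at hk
    rw [hk] at hp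
    exact hp hq
  have hk0 : k ≠ 0 := by rintro rfl; omega
  have hqk : q ≤ k := Nat.minFac_le_of_dvd (by omega) (Dvd.intro_left _ hk.symm)
  have hq1 := hq.one_lt
  have hq3 : q % 3 ≠ 0 := by
    intro h0
    rw [hk, Nat.mul_mod, h0] at hm3
    simp at hm3
  have hq31 : q % 3 ≠ 1 := fun h1 => no_fact_three hn h q k hk.symm hq1 (by omega) h1
  refine ⟨q, k, hq, ?_, by rintro h; rw [h] at hq3; simp at hq3, hqk, hk.symm⟩
  by_contra hkp
  obtain ⟨a, b, ha, hb, hab⟩ := (Nat.not_prime_iff_exists_mul_eq (by omega)).1 hkp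
  have ha1 : a ≠ 1 := by rintro rfl; omega
  have hb1 : b ≠ 1 := by rintro rfl; omega
  have ha0 : a ≠ 0 := by rintro rfl; omega
  have hb0 : b ≠ 0 := by rintro rfl; omega
  have hqab : m = q * (a * b) := by rw [hab]; exact hk
  have ha3 : a % 3 ≠ 0 := by
    intro h0
    rw [hqab, Nat.mul_mod, Nat.mul_mod a, h0] at hm3
    simp at hm3
  by_cases h1 : a % 3 = 1
  · refine no_fact_three hn h a (q * b) (by rw [← hm, hqab]; ring) (by omega) ?_ h1
    have : q * 1 ≤ q * b := Nat.mul_le_mul_left q (by omega)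
    omega
  · refine no_fact_three hn h (q * a) b (by rw [← hm, hqab]; ring) ?_ (by omega) ?_
    · have : q * 1 ≤ q * a := Nat.mul_le_mul_left q (by omega)
      omega
    · have e1 : q % 3 = 2 := by omega
      have e2 : a % 3 = 2 := by omega
      rw [Nat.mul_mod, e1, e2]

lemma cover {n y : ℕ} {X : ℝ} (hn : 10 ≤ n) (hnX : (n : ℝ) ≤ X) (hny : (y ^ 3) ^ 2 < n)
    (h : ¬∃ x y z : ℕ, 0 < x ∧ 0 < y ∧ 0 < z ∧ n = x * y * z + x + y + z) :
    n ∈ sifted X 1 2 y ∨ ∃ q : ℕ, q.Prime ∧ q ≠ 3 ∧ (q : ℝ) ^ 2 ≤ 3 * X ∧ n ∈ sifted X q q y := by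
  classical
  have h1 := n_prime hn h
  have h2 := two_n_prime hn h
  set D := y ^ 3 with hD
  have hDn : D < n := lt_of_le_of_lt (by nlinarith [sq_nonneg (D : ℤ), Nat.le_self_pow two_ne_zero D]) hny
  have hIcc : n ∈ Finset.Icc 3 ⌊X⌋₊ := mem_Icc.2 ⟨by omega, Nat.le_floor hnX⟩
  have hnd : ∀ p r : ℕ, p.Prime → r.Prime → r ≤ D → D < p → ¬ r ∣ p := by
    intro p r hp hr hrD hDp hd
    have := (Nat.prime_dvd_prime_iff_eq hr hp).1 hd
    omega
  rcases three_n_cases hn h with h3 | ⟨q, k, hq, hk, hq3, hqk, hm⟩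
  · left
    unfold sifted
    refine mem_filter.2 ⟨hIcc, one_dvd _, ?_⟩
    intro r hr hrD _ _ _ _ hd
    unfold ff at hd
    rcases hr.dvd_mul.1 hd with hd | hd
    · rcases hr.dvd_mul.1 hd with hd | hd
      · exact hnd _ r h1 hr hrD hDn hd
      · exact hnd _ r h2 hr hrD (by omega) hd
    · exact hnd _ r h3 hr hrD (by omega) hd
  · right
    have hDk : D < k := by
      by_contra hle
      have : q * k ≤ D * D := Nat.mul_le_mul (by omega) (by omega)
      have e : D ^ 2 = D * D := by ring
      omega
    refine ⟨q, hq, hq3, ?_, ?_⟩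
    · have e1 : q ^ 2 ≤ 3 * n := by
        have : q * q ≤ q * k := Nat.mul_le_mul_left q hqk
        have e : q ^ 2 = q * q := by ring
        omega
      have : ((q ^ 2 : ℕ) : ℝ) ≤ ((3 * n : ℕ) : ℝ) := by exact_mod_cast e1
      push_cast at this
      linarith
    · unfold sifted
      refine mem_filter.2 ⟨hIcc, Dvd.intro _ hm, ?_⟩
      intro r hr hrD _ _ _ hrq hd
      unfold ff at hd
      rcases hr.dvd_mul.1 hd with hd | hd
      · rcases hr.dvd_mul.1 hd with hd | hd
        · exact hnd _ r h1 hr hrD hDn hd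
        · exact hnd _ r h2 hr hrD (by omega) hd
      · rw [← hm] at hd
        rcases hr.dvd_mul.1 hd with hd | hd
        · exact hrq ((Nat.prime_dvd_prime_iff_eq hr hq).1 hd)
        · exact hnd _ r hk hr hrD hDk hd

end Cover

section Mertens

lemma dyadic_bound (K : ℕ) (hK : 1 ≤ K) :
    ∑ p ∈ (Finset.Ioc (2 ^ K) (2 ^ (K + 1))).filter Nat.Prime, (1 : ℝ) / p ≤ 4 / K := by
  have hl2 : 0 < Real.log 2 := Real.log_pos (by norm_num)
  have hK' : (0 : ℝ) < K := by exact_mod_cast hK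
  have hθ := Chebyshev.theta_le_log4_mul_x (x := ((2 ^ (K + 1) : ℕ) : ℝ)) (by positivity)
  have hθ2 : ∑ p ∈ (Finset.Ioc (2 ^ K) (2 ^ (K + 1))).filter Nat.Prime, Real.log p ≤
      Chebyshev.theta ((2 ^ (K + 1) : ℕ) : ℝ) := by
    unfold Chebyshev.theta
    rw [Nat.floor_natCast]
    apply Finset.sum_le_sum_of_subset_of_nonneg
    · intro p hp
      simp only [mem_filter, mem_Ioc] at hp ⊢
      exact ⟨⟨hp.2.pos, hp.1.2⟩, hp.2⟩
    · intro p _ _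
      exact Real.log_natCast_nonneg p
  have hterm : ∀ p ∈ (Finset.Ioc (2 ^ K) (2 ^ (K + 1))).filter Nat.Prime,
      (1 : ℝ) / p ≤ Real.log p / (2 ^ K * (K * Real.log 2)) := by
    intro p hp
    simp only [mem_filter, mem_Ioc] at hp
    have h1 : (2 : ℝ) ^ K < p := by exact_mod_cast hp.1.1
    have h2 : K * Real.log 2 ≤ Real.log p := by
      rw [← Real.log_pow]
      exact Real.log_le_log (by positivity) h1.le
    have hp0 : (0 : ℝ) < p := lt_trans (by positivity) h1
    rw [div_le_div_iff₀ hp0 (by positivity), one_mul]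
    rw [mul_comm]
    exact mul_le_mul h2 h1.le (by positivity) (Real.log_natCast_nonneg p)
  refine (Finset.sum_le_sum hterm).trans ?_
  rw [← Finset.sum_div]
  have h4 : Real.log 4 = 2 * Real.log 2 := by
    rw [show (4 : ℝ) = 2 ^ 2 by norm_num, Real.log_pow]; norm_num
  rw [div_le_div_iff₀ (by positivity) hK']
  have h5 := hθ2.trans hθ
  rw [h4] at h5
  push_cast at h5
  calc _ ≤ (2 * Real.log 2 * 2 ^ (K + 1)) * K := by gcongr
    _ = _ := by ring

lemma mertens_dyadic (K : ℕ) :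
    ∑ p ∈ (Finset.Icc 1 (2 ^ (K + 1))).filter Nat.Prime, (1 : ℝ) / p ≤ 1 + 4 * (harmonic K : ℝ) := by
  induction K with
  | zero =>
    have : (Finset.Icc 1 (2 ^ (0 + 1))).filter Nat.Prime = {2} := by decide
    rw [this]
    norm_num
  | succ K ih =>
    have hsub : (Finset.Icc 1 (2 ^ (K + 1 + 1))).filter Nat.Prime ⊆
        (Finset.Icc 1 (2 ^ (K + 1))).filter Nat.Prime ∪
        (Finset.Ioc (2 ^ (K + 1)) (2 ^ (K + 1 + 1))).filter Nat.Prime := by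
      intro p hp
      simp only [mem_filter, mem_union, mem_Ioc, mem_Icc] at hp ⊢
      by_cases h : p ≤ 2 ^ (K + 1)
      · exact Or.inl ⟨⟨hp.1.1, h⟩, hp.2⟩
      · exact Or.inr ⟨⟨by omega, hp.1.2⟩, hp.2⟩
    have hd : Disjoint ((Finset.Icc 1 (2 ^ (K + 1))).filter Nat.Prime)
        ((Finset.Ioc (2 ^ (K + 1)) (2 ^ (K + 1 + 1))).filter Nat.Prime) := by
      rw [Finset.disjoint_left]
      intro p hp hp'
      simp only [mem_filter, mem_Ioc, mem_Icc] at hp hp'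
      omega
    have h1 := Finset.sum_le_sum_of_subset_of_nonneg (f := fun p : ℕ => (1 : ℝ) / p) hsub
      (fun p _ _ => by positivity)
    rw [Finset.sum_union hd] at h1
    have h2 := dyadic_bound (K + 1) (by omega)
    rw [harmonic_succ]
    push_cast at h2 ⊢
    have e : 4 / ((K : ℝ) + 1) = 4 * ((K : ℝ) + 1)⁻¹ := by rw [div_eq_mul_inv]
    linarith

lemma mertens_upper (X : ℝ) (hX : 3 ≤ X) :
    ∑ p ∈ (Finset.Icc 1 ⌊X⌋₊).filter Nat.Prime, (1 : ℝ) / p ≤ 9 + 4 * Real.log (Real.log X) := by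
  have hl2 : 1 / 2 < Real.log 2 := by have := Real.log_two_gt_d9; linarith
  have hl2' : Real.log 2 < 1 := by have := Real.log_two_lt_d9; linarith
  have hLX : Real.log 2 ≤ Real.log X := Real.log_le_log (by norm_num) (by linarith)
  have hLpos : 0 < Real.log X := by linarith
  set K := ⌊Real.log X / Real.log 2⌋₊ with hK
  have hK1 : 1 ≤ K := Nat.le_floor (by rw [le_div_iff₀ (by linarith)]; simpa using hLX)
  have hK2 : (K : ℝ) ≤ Real.log X / Real.log 2 := Nat.floor_le (div_nonneg hLpos.le (by linarith))
  have hK3 : Real.log X / Real.log 2 < K + 1 := Nat.lt_floor_add_one _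
  have hXK : X ≤ ((2 ^ (K + 1) : ℕ) : ℝ) := by
    rw [div_lt_iff₀ (by linarith)] at hK3
    push_cast
    rw [← Real.log_le_log_iff (by linarith) (by positivity), Real.log_pow]
    push_cast
    exact hK3.le
  have hfl : ⌊X⌋₊ ≤ 2 ^ (K + 1) := by
    have := Nat.floor_mono hXK
    rwa [Nat.floor_natCast] at this
  have h1 : ∑ p ∈ (Finset.Icc 1 ⌊X⌋₊).filter Nat.Prime, (1 : ℝ) / p ≤
      ∑ p ∈ (Finset.Icc 1 (2 ^ (K + 1))).filter Nat.Prime, (1 : ℝ) / p := by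
    apply Finset.sum_le_sum_of_subset_of_nonneg
    · exact Finset.filter_subset_filter _ (Finset.Icc_subset_Icc_right hfl)
    · intro p _ _; positivity
  have h2 := mertens_dyadic K
  have h3 := harmonic_le_one_add_log K
  have h4 : Real.log K ≤ 1 + Real.log (Real.log X) := by
    have hK0 : (0 : ℝ) < K := by exact_mod_cast hK1
    have : (K : ℝ) ≤ 2 * Real.log X := by
      refine hK2.trans ?_
      rw [div_le_iff₀ (by linarith)]
      nlinarith
    have h5 := Real.log_le_log hK0 this
    rw [Real.log_mul (by norm_num) hLpos.ne'] at h5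
    linarith
  linarith

end Mertens

section Final

open Classical in
lemma count_bound (X : ℝ) (hX : 3 ≤ X) (y : ℕ) (hy : 1 ≤ y) (u : ℝ) (hu : 1 ≤ u) (hyu : (y : ℝ) ≤ u)
    (hXu : X = u ^ 30) :
    ({n : ℕ | 0 < n ∧ (n : ℝ) ≤ X ∧
          ¬∃ x y z : ℕ, 0 < x ∧ 0 < y ∧ 0 < z ∧
            n = x * y * z + x + y + z}.ncard : ℝ) ≤
      24 * u ^ 27 + X / (Real.log (y + 1) / 16) ^ 3 * (10 + 4 * Real.log (Real.log X)) := by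
  set B := X / (Real.log (y + 1) / 16) ^ 3 with hB
  have hy' : (1 : ℝ) ≤ y := by exact_mod_cast hy
  have hB0 : 0 ≤ B := by
    have : 0 ≤ Real.log (y + 1) := Real.log_nonneg (by linarith)
    positivity
  set Q := ⌊2 * u ^ 15⌋₊ with hQ
  set P := (Finset.Icc 1 (min Q ⌊X⌋₊)).filter (fun q => Nat.Prime q ∧ q ≠ 3) with hP
  have hsub : {n : ℕ | 0 < n ∧ (n : ℝ) ≤ X ∧
          ¬∃ x y z : ℕ, 0 < x ∧ 0 < y ∧ 0 < z ∧ n = x * y * z + x + y + z} ⊆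
      ((Finset.range (10 + (y ^ 3) ^ 2 + 1) ∪ (sifted X 1 2 y ∪ P.biUnion (fun q => sifted X q q y)) :
        Finset ℕ) : Set ℕ) := by
    rintro n ⟨hn0, hnX, hn⟩
    simp only [Finset.mem_coe, mem_union, mem_range, mem_biUnion]
    by_cases hsmall : n < 10 + (y ^ 3) ^ 2 + 1
    · exact Or.inl hsmall
    right
    rcases cover (y := y) (by omega) hnX (by omega) hn with h | ⟨q, hq, hq3, hqX, h⟩
    · exact Or.inl h
    · right
      refine ⟨q, ?_, h⟩
      have hqX' : (q : ℝ) ≤ X := by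
        by_contra hlt
        push Not at hlt
        nlinarith
      have hqu : (q : ℝ) ≤ 2 * u ^ 15 := by
        by_contra hlt
        push Not at hlt
        have h15 : 0 < u ^ 15 := by positivity
        have e : u ^ 30 = u ^ 15 * u ^ 15 := by ring
        nlinarith
      simp only [hP, mem_filter, mem_Icc, le_min_iff]
      exact ⟨⟨hq.pos, Nat.le_floor hqu, Nat.le_floor hqX'⟩, hq, hq3⟩
  have h1 := Set.ncard_le_ncard hsub (Finset.finite_toSet _)
  rw [Set.ncard_coe_finset] at h1
  have h2 : (Finset.range (10 + (y ^ 3) ^ 2 + 1) ∪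
      (sifted X 1 2 y ∪ P.biUnion (fun q => sifted X q q y))).card ≤
      (10 + (y ^ 3) ^ 2 + 1) + ((sifted X 1 2 y).card + ∑ q ∈ P, (sifted X q q y).card) := by
    refine (Finset.card_union_le _ _).trans ?_
    rw [Finset.card_range]
    gcongr
    refine (Finset.card_union_le _ _).trans ?_
    gcongr
    exact Finset.card_biUnion_le
  have h3 := h1.trans h2
  have h3' := (Nat.cast_le (α := ℝ)).2 h3
  push_cast at h3'
  have s1 : ((sifted X 1 2 y).card : ℝ) ≤ B + 4 * u ^ 12 := by
    have := sieve_bound X hX 1 2 y hy one_pos (by norm_num) Nat.prime_two (fun r _ _ => by simp)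
    simp only [Nat.cast_one, div_one] at this
    refine this.trans ?_
    gcongr
  have s2 : ∀ q ∈ P, ((sifted X q q y).card : ℝ) ≤ B * (1 / q) + 4 * u ^ 12 := by
    intro q hq
    simp only [hP, mem_filter] at hq
    have := sieve_bound X hX q q y hy hq.2.1.pos
      ((Nat.coprime_primes Nat.prime_three hq.2.1).2 (Ne.symm hq.2.2)) hq.2.1
      (fun r hr hrq => (Nat.coprime_primes hq.2.1 hr).2 (Ne.symm hrq))
    refine this.trans ?_
    have e : X / q / (Real.log (y + 1) / 16) ^ 3 = B * (1 / q) := by rw [hB]; ring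
    rw [e]
    gcongr
  have s3 := Finset.sum_le_sum s2
  rw [Finset.sum_add_distrib, ← Finset.mul_sum, Finset.sum_const, nsmul_eq_mul] at s3
  have s4 : (P.card : ℝ) ≤ 2 * u ^ 15 := by
    have : P.card ≤ Q := by
      refine (Finset.card_filter_le _ _).trans ?_
      simp
    refine le_trans (by exact_mod_cast this) (Nat.floor_le (by positivity))
  have s5 : ∑ q ∈ P, (1 : ℝ) / q ≤ 9 + 4 * Real.log (Real.log X) := by
    refine le_trans ?_ (mertens_upper X hX)
    apply Finset.sum_le_sum_of_subset_of_nonneg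
    · intro q hq
      simp only [hP, mem_filter, mem_Icc, le_min_iff] at hq ⊢
      exact ⟨⟨hq.1.1, hq.1.2.2⟩, hq.2.1⟩
    · intro p _ _; positivity
  have s6 : B * ∑ q ∈ P, (1 : ℝ) / q ≤ B * (9 + 4 * Real.log (Real.log X)) :=
    mul_le_mul_of_nonneg_left s5 hB0
  have s7 : (P.card : ℝ) * (4 * u ^ 12) ≤ 8 * u ^ 27 := by
    calc (P.card : ℝ) * (4 * u ^ 12) ≤ 2 * u ^ 15 * (4 * u ^ 12) := by gcongr
      _ = _ := by ring
  have s8 : ((y : ℝ) ^ 3) ^ 2 ≤ u ^ 27 := by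
    calc ((y : ℝ) ^ 3) ^ 2 = (y : ℝ) ^ 6 := by ring
      _ ≤ u ^ 6 := by gcongr
      _ ≤ u ^ 27 := pow_le_pow_right₀ hu (by norm_num)
  have s9 : u ^ 12 ≤ u ^ 27 := pow_le_pow_right₀ hu (by norm_num)
  have s10 : 1 ≤ u ^ 27 := one_le_pow₀ hu
  linarith

end Final

/-- The number of positive integers `n ≤ X` not expressible as
`n = xyz + x + y + z` with positive integers `x, y, z` is
`≤ c·X·(log log X)/(log X)³`. -/
theorem unrepresented_bound_log_cubed :
    ∃ c : ℝ, 0 < c ∧ ∀ X : ℝ, 3 ≤ X →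
      ({n : ℕ | 0 < n ∧ (n : ℝ) ≤ X ∧
          ¬∃ x y z : ℕ, 0 < x ∧ 0 < y ∧ 0 < z ∧
            n = x * y * z + x + y + z}.ncard : ℝ)
        ≤ c * X * Real.log (Real.log X) / Real.log X ^ 3 := by
  have hl3 : 1 < Real.log 3 := by
    rw [Real.lt_log_iff_exp_lt (by norm_num)]
    exact lt_trans Real.exp_one_lt_d9 (by norm_num)
  set δ := Real.log (Real.log 3) with hδ
  have hδ0 : 0 < δ := Real.log_pos hl3
  refine ⟨(24 * 27000 + 10 * 480 ^ 3) / δ + 4 * 480 ^ 3, by positivity, ?_⟩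
  intro X hX
  have hX0 : 0 < X := by linarith
  have hL3 : Real.log 3 ≤ Real.log X := Real.log_le_log (by norm_num) hX
  have hL0 : 0 < Real.log X := by linarith
  have hLL : δ ≤ Real.log (Real.log X) := Real.log_le_log (by linarith) hL3
  set L := Real.log X with hL
  set M := Real.log L with hM
  set u := X ^ ((1 : ℝ) / 30) with hu
  have hu1 : 1 ≤ u := Real.one_le_rpow (by linarith) (by norm_num)
  have hXu : X = u ^ 30 := by
    rw [hu, ← Real.rpow_natCast, ← Real.rpow_mul hX0.le]
    norm_num
  have hLu : L = 30 * Real.log u := by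
    rw [hL, hXu, Real.log_pow]; norm_num
  have hLu2 : L ≤ 30 * u := by
    have := Real.log_le_sub_one_of_pos (show 0 < u by linarith)
    linarith
  set y := ⌊u⌋₊ with hy
  have hy1 : 1 ≤ y := Nat.le_floor (by simpa using hu1)
  have hyu : (y : ℝ) ≤ u := Nat.floor_le (by linarith)
  have hyu2 : u < y + 1 := Nat.lt_floor_add_one u
  have hlog : L / 480 ≤ Real.log (y + 1) / 16 := by
    have := Real.log_le_log (by linarith) hyu2.le
    linarith
  have hmain := count_bound X hX y hy1 u hu1 hyu hXu
  refine hmain.trans ?_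
  rw [← hL, ← hM]
  have hM0 : 0 < M := by linarith
  have t1 : X / (Real.log (y + 1) / 16) ^ 3 ≤ X / (L / 480) ^ 3 := by gcongr
  have t1' : X / (L / 480) ^ 3 = 480 ^ 3 * (X / L ^ 3) := by field_simp
  have t2 : u ^ 27 ≤ 27000 * (X / L ^ 3) := by
    rw [← mul_div_assoc, le_div_iff₀ (by positivity)]
    calc u ^ 27 * L ^ 3 ≤ u ^ 27 * (30 * u) ^ 3 := by gcongr
      _ = 27000 * X := by rw [hXu]; ring
  have t3 : 1 ≤ M / δ := by rw [le_div_iff₀ hδ0]; linarith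
  set W := X / L ^ 3 with hW
  have hW0 : 0 ≤ W := by positivity
  calc 24 * u ^ 27 + X / (Real.log (y + 1) / 16) ^ 3 * (10 + 4 * M)
      ≤ 24 * (27000 * W) + (480 ^ 3 * W) * (10 + 4 * M) := by
        rw [t1'] at t1
        gcongr
    _ = W * ((24 * 27000 + 10 * 480 ^ 3) * 1 + 4 * 480 ^ 3 * M) := by ring
    _ ≤ W * ((24 * 27000 + 10 * 480 ^ 3) * (M / δ) + 4 * 480 ^ 3 * M) := by gcongr
    _ = _ := by rw [hW]; ring
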